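/- Let F : ℝⁿ\{0} → ℝ be positively 1-homogeneous and smooth, and define its symmetrization F_s(y) = ½(F(y) + F(−y)). If F satisfies the linear system F_{y^ky^i}(2Γ^i_s + T^i_s) − F_{y^sy^i}(2Γ^i_k + T^i_k) − 2F_{y^i}T^i_{ks} = 0 for all k < s (with Γ^i_s, T^i_s, T^i_{ks} as quadratic/linear/constant functions of y as above), then F_s also satisfies the same system. -/

import Mathlib

open Real

/-- First partial derivative `F_{y^i}`. -/
noncomputable def pd {n : ℕ} (F : (Fin n → ℝ) → ℝ) (y : Fin n → ℝ) (i : Fin n) : ℝ :=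
  fderiv ℝ F y (Pi.single i 1)

/-- Second partial derivative `F_{y^i y^j}`. -/
noncomputable def pd2 {n : ℕ} (F : (Fin n → ℝ) → ℝ) (y : Fin n → ℝ) (i j : Fin n) : ℝ :=
  fderiv ℝ (fun z => fderiv ℝ F z (Pi.single i 1)) y (Pi.single j 1)

theorem fderiv_add_comp_neg_half_apply {E : Type*} [NormedAddCommGroup E] [NormedSpace ℝ E]
    {f : E → ℝ} {y : E} (hf : DifferentiableAt ℝ f y) (hf' : DifferentiableAt ℝ f (-y)) (v : E) :
    fderiv ℝ (fun z => (f z + f (-z)) / 2) y v = (fderiv ℝ f y v - fderiv ℝ f (-y) v) / 2 := by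
  have h := hf.hasFDerivAt.add (hf'.hasFDerivAt.comp y (hasFDerivAt_id y).neg)
  have h' := h.mul_const (2⁻¹ : ℝ)
  have h'' : HasFDerivAt (fun z => (f z + f (-z)) / 2) _ y := h'
  rw [h''.fderiv]
  simp
  ring

theorem fderiv_sub_comp_neg_half_apply {E : Type*} [NormedAddCommGroup E] [NormedSpace ℝ E]
    {f : E → ℝ} {y : E} (hf : DifferentiableAt ℝ f y) (hf' : DifferentiableAt ℝ f (-y)) (v : E) :
    fderiv ℝ (fun z => (f z - f (-z)) / 2) y v = (fderiv ℝ f y v + fderiv ℝ f (-y) v) / 2 := by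
  have h := hf.hasFDerivAt.sub (hf'.hasFDerivAt.comp y (hasFDerivAt_id y).neg)
  have h' := h.mul_const (2⁻¹ : ℝ)
  have h'' : HasFDerivAt (fun z => (f z - f (-z)) / 2) _ y := h'
  rw [h''.fderiv]
  simp
  ring

theorem pd_symmetrization {n : ℕ} {F : (Fin n → ℝ) → ℝ}
    (hF : ContDiffOn ℝ (⊤ : ℕ∞) F {y : Fin n → ℝ | y ≠ 0})
    {y : Fin n → ℝ} (hy : y ≠ 0) (i : Fin n) :
    pd (fun z => (F z + F (-z)) / 2) y i = (pd F y i - pd F (-y) i) / 2 := by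
  have hd : ∀ z : Fin n → ℝ, z ≠ 0 → DifferentiableAt ℝ F z := fun z hz =>
    (hF.contDiffAt (isOpen_ne.mem_nhds hz)).differentiableAt (by simp)
  exact fderiv_add_comp_neg_half_apply (hd y hy) (hd (-y) (neg_ne_zero.mpr hy)) _

theorem pd2_symmetrization {n : ℕ} {F : (Fin n → ℝ) → ℝ}
    (hF : ContDiffOn ℝ (⊤ : ℕ∞) F {y : Fin n → ℝ | y ≠ 0})
    {y : Fin n → ℝ} (hy : y ≠ 0) (i j : Fin n) :
    pd2 (fun z => (F z + F (-z)) / 2) y i j = (pd2 F y i j + pd2 F (-y) i j) / 2 := by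
  have hd : ∀ z : Fin n → ℝ, z ≠ 0 → DifferentiableAt ℝ (fun w => pd F w i) z := fun z hz =>
    (((hF.contDiffAt (isOpen_ne.mem_nhds hz)).fderiv_right (m := 1)
      (by norm_cast)).differentiableAt (by simp)).clm_apply
      (differentiableAt_const _)
  have heq : (fun z => pd (fun z => (F z + F (-z)) / 2) z i) =ᶠ[nhds y]
      fun z => (pd F z i - pd F (-z) i) / 2 := by
    filter_upwards [isOpen_ne.mem_nhds hy] with z hz
    exact pd_symmetrization hF hz i
  change fderiv ℝ (fun z => pd (fun z => (F z + F (-z)) / 2) z i) y _ = _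
  rw [heq.fderiv_eq]
  exact fderiv_sub_comp_neg_half_apply (hd y hy) (hd (-y) (neg_ne_zero.mpr hy)) _

theorem stmt16 (n : ℕ) (F : (Fin n → ℝ) → ℝ)
    (hhom : ∀ c : ℝ, 0 < c → ∀ y : Fin n → ℝ, F (c • y) = c * F y)
    (hFsmooth : ContDiffOn ℝ (⊤ : ℕ∞) F {y : Fin n → ℝ | y ≠ 0})
    (Γ : Fin n → Fin n → Fin n → ℝ) (T : Fin n → Fin n → Fin n → ℝ)
    (hsys : ∀ y : Fin n → ℝ, y ≠ 0 → ∀ k s : Fin n, k < s →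
        (∑ i, pd2 F y k i * (2 * (∑ m, Γ i s m * y m) + (∑ m, T i s m * y m)))
          - (∑ i, pd2 F y s i * (2 * (∑ m, Γ i k m * y m) + (∑ m, T i k m * y m)))
          - 2 * (∑ i, pd F y i * T i k s) = 0) :
    ∀ y : Fin n → ℝ, y ≠ 0 → ∀ k s : Fin n, k < s →
        (∑ i, pd2 (fun z => (F z + F (-z)) / 2) y k i
            * (2 * (∑ m, Γ i s m * y m) + (∑ m, T i s m * y m)))
          - (∑ i, pd2 (fun z => (F z + F (-z)) / 2) y s i
            * (2 * (∑ m, Γ i k m * y m) + (∑ m, T i k m * y m)))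
          - 2 * (∑ i, pd (fun z => (F z + F (-z)) / 2) y i * T i k s) = 0 := by
  intro y hy k s hks
  have h1 := hsys y hy k s hks
  have h2 := hsys (-y) (neg_ne_zero.mpr hy) k s hks
  simp only [pd_symmetrization hFsmooth hy, pd2_symmetrization hFsmooth hy]
  simp only [Pi.neg_apply, mul_neg, Finset.sum_neg_distrib, ← neg_add, add_mul, sub_mul,
    div_mul_eq_mul_div, ← Finset.sum_div, Finset.sum_add_distrib, Finset.sum_sub_distrib]
    at h1 h2 ⊢
  linarith
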